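/- arXiv:0709.3350 — 6 statements merged into one kernel-verified Lean document; each statement's English description precedes it below -/
import Mathlib

section
/- Let p ≥ 1 and let φ : su(1,1) → su(p,p) be an ℝ-linear map that preserves Lie brackets, i.e. φ⁅M,N⁆ = ⁅φ M, φ N⁆ for all M, N ∈ su(1,1). Assume: (i) both off-diagonal p×p blocks of φ(w) vanish, where w = !![i,0;0,-i]; and (ii) (holomorphy) the top-right p×p block of φ(v) equals i times the top-right p×p block of φ(u), where u = !![0,1;1,0] and v = !![0,i;-i,0]. Then both diagonal p×p blocks of φ(u) vanish and both diagonal p×p blocks of φ(v) vanish. (This says that every equivariant holomorphic embedding of the unit disc, the symmetric space of SU(1,1), into the symmetric space of SU(p,p) is totally geodesic: the Lie algebra homomorphism maps the tangent part p_H of su(1,1) into the tangent part p of su(p,p).) -/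
open Matrix

/-- The matrix `J_{p,q} = fromBlocks 1 0 0 (-1)` defining the Hermitian form of
signature `(p,q)`. -/
def Jpq (p q : ℕ) : Matrix (Fin p ⊕ Fin q) (Fin p ⊕ Fin q) ℂ :=
  Matrix.fromBlocks 1 0 0 (-1)

/-- The real Lie algebra `su(p,q)`: traceless complex matrices `M` with
`Mᴴ * J + J * M = 0`. -/
def su (p q : ℕ) : Set (Matrix (Fin p ⊕ Fin q) (Fin p ⊕ Fin q) ℂ) :=
  {M | Mᴴ * Jpq p q + Jpq p q * M = 0 ∧ M.trace = 0}

/-- `su(1,1)`, realized as `2 × 2` matrices, with `J_{1,1} = !![1,0;0,-1]`. -/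
def su11 : Set (Matrix (Fin 2) (Fin 2) ℂ) :=
  {M | Mᴴ * !![1, 0; 0, -1] + !![1, 0; 0, -1] * M = 0 ∧ M.trace = 0}

section LadderOperators

open scoped ComplexOrder

variable {n : Type*} [Fintype n] [DecidableEq n]

theorem eq_zero_of_posSemidef_of_mul_eq_neg {H N : Matrix n n ℂ} (hH : H.PosSemidef)
    (h : H * N = -(2 * N)) : N = 0 := by
  rw [← Matrix.trace_conjTranspose_mul_self_eq_zero_iff]
  have h1 := (hH.conjTranspose_mul_mul_same N).trace_nonneg
  have h2 := (Matrix.posSemidef_conjTranspose_mul_self N).trace_nonneg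
  have h3 : (Nᴴ * H * N).trace = -((Nᴴ * N).trace + (Nᴴ * N).trace) := by
    rw [← Matrix.trace_add, ← Matrix.trace_neg, Matrix.mul_assoc, h]
    congr 1
    noncomm_ring
  rw [h3, neg_nonneg] at h1
  exact le_antisymm ((le_add_of_nonneg_left h2).trans h1) h2

theorem mul_eq_zero_of_posSemidef_of_intertwines {H K M : Matrix n n ℂ} (hH : H.PosSemidef)
    (hK : (-K).PosSemidef) (h : H * M = M * K) : H * M = 0 := by
  have h1 := hH.conjTranspose_mul_mul_same M
  have h2 := (hK.mul_mul_conjTranspose_same M).trace_nonneg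
  have h3 : (M * -K * Mᴴ).trace = -(Mᴴ * H * M).trace := by
    rw [Matrix.mul_assoc Mᴴ, h, Matrix.trace_mul_comm Mᴴ, ← Matrix.trace_neg]
    congr 1
    noncomm_ring
  rw [h3, neg_nonneg] at h2
  have h4 := h1.trace_eq_zero_iff.1 (le_antisymm h2 h1.trace_nonneg)
  apply Matrix.toLin'.injective
  refine LinearMap.ext fun x => ?_
  have h5 := (hH.dotProduct_mulVec_zero_iff (M *ᵥ x)).1 (by
    rw [Matrix.star_mulVec, ← Matrix.dotProduct_mulVec, Matrix.mulVec_mulVec,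
      Matrix.mulVec_mulVec, h4]
    simp)
  simpa using h5

/-- A Hermitian matrix `H` lowered by `C` whose failure to be `[C, Cᴴ]` is positive
semidefinite is itself positive semidefinite. -/
theorem posSemidef_of_lowering {H B C : Matrix n n ℂ}
    (hH : H = B * Bᴴ + C * Cᴴ - Cᴴ * C) (hC : H * C = C * H - 2 * C) : H.PosSemidef := by
  have hherm : H.IsHermitian := by
    rw [hH]
    simp [Matrix.IsHermitian]
  rw [hherm.posSemidef_iff_eigenvalues_nonneg]
  intro j
  obtain ⟨i, -, hi⟩ := Finset.exists_min_image Finset.univ hherm.eigenvalues ⟨j, by simp⟩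
  refine le_trans ?_ (hi j (by simp))
  set x : n → ℂ := ⇑(hherm.eigenvectorBasis i)
  have hx : H *ᵥ x = hherm.eigenvalues i • x := hherm.mulVec_eigenvectorBasis i
  have hCx : C *ᵥ x = 0 := by
    by_contra hne
    have hmem : hherm.eigenvalues i - 2 ∈ spectrum ℝ H := by
      intro hu
      apply hne
      apply Matrix.mulVec_injective_of_isUnit hu
      have h1 : H *ᵥ C *ᵥ x = hherm.eigenvalues i • C *ᵥ x - (2 : ℝ) • C *ᵥ x := by
        rw [Matrix.mulVec_mulVec, hC, Matrix.sub_mulVec, ← Matrix.mulVec_mulVec, hx,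
          Matrix.mulVec_smul, two_mul, Matrix.add_mulVec, two_smul]
      rw [Matrix.sub_mulVec, h1, Algebra.algebraMap_eq_smul_one, Matrix.smul_mulVec,
        Matrix.one_mulVec, sub_smul, Matrix.mulVec_zero, sub_self]
    rw [hherm.spectrum_real_eq_range_eigenvalues] at hmem
    obtain ⟨k, hk⟩ := hmem
    have := hi k (by simp)
    linarith
  rw [hherm.eigenvalues_eq]
  have h2 : H *ᵥ x = (B * Bᴴ + C * Cᴴ) *ᵥ x := by
    rw [hH, Matrix.sub_mulVec, ← Matrix.mulVec_mulVec x Cᴴ C, hCx]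
    simp
  change 0 ≤ RCLike.re (star x ⬝ᵥ H *ᵥ x)
  rw [h2]
  exact ((Matrix.posSemidef_self_mul_conjTranspose B).add
    (Matrix.posSemidef_self_mul_conjTranspose C)).re_dotProduct_nonneg x

theorem lowering_mul_eq_zero {H K B C : Matrix n n ℂ}
    (hH : H = B * Bᴴ + C * Cᴴ - Cᴴ * C) (hC : H * C = C * H - 2 * C)
    (hB : H * B = B * K + 2 * B) (hK : (-K).PosSemidef) : C * B = 0 := by
  have hpos := posSemidef_of_lowering hH hC
  have h1 : H * (C * B) = C * B * K := by
    linear_combination (norm := noncomm_ring) hC * B + C * hB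
  have h2 := mul_eq_zero_of_posSemidef_of_intertwines hpos hK h1
  have h3 : C * (C * B) = 0 := by
    refine eq_zero_of_posSemidef_of_mul_eq_neg hpos ?_
    linear_combination (norm := noncomm_ring) hC * (C * B) + C * h2
  have h4 : (Bᴴ * (C * B))ᴴ * (Bᴴ * (C * B)) + (Cᴴ * (C * B))ᴴ * (Cᴴ * (C * B)) = 0 := by
    have h5 : (C * B)ᴴ * (B * Bᴴ + C * Cᴴ - Cᴴ * C) * (C * B) = 0 := by
      rw [← hH, Matrix.mul_assoc, h2, Matrix.mul_zero]
    simp only [Matrix.conjTranspose_mul, Matrix.conjTranspose_conjTranspose] at h5 ⊢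
    linear_combination (norm := noncomm_ring) h5 + Bᴴ * Cᴴ * Cᴴ * h3
  have h6 : Cᴴ * (C * B) = 0 := by
    rw [← Matrix.trace_conjTranspose_mul_self_eq_zero_iff]
    have h7 := congrArg Matrix.trace h4
    rw [Matrix.trace_add, Matrix.trace_zero] at h7
    have h8 := (Matrix.posSemidef_conjTranspose_mul_self (Bᴴ * (C * B))).trace_nonneg
    have h9 := (Matrix.posSemidef_conjTranspose_mul_self (Cᴴ * (C * B))).trace_nonneg
    exact ((add_eq_zero_iff_of_nonneg h8 h9).1 h7).2
  rw [← Matrix.conjTranspose_mul_self_eq_zero, Matrix.conjTranspose_mul, Matrix.mul_assoc, h6,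
    Matrix.mul_zero]

theorem lowering_eq_zero {H B C : Matrix n n ℂ}
    (hH : H = B * Bᴴ + C * Cᴴ - Cᴴ * C) (hC : H * C = C * H - 2 * C) (hCB : C * B = 0) :
    C = 0 := by
  rw [← Matrix.trace_mul_conjTranspose_self_eq_zero_iff]
  set S := C * Cᴴ - Cᴴ * C with hS
  have hSH : Sᴴ = S := by simp [hS]
  have h1 : (H * S).trace = -((C * Cᴴ).trace + (C * Cᴴ).trace) := by
    have h2 : H * S = C * (H * Cᴴ) - H * Cᴴ * C - (C * Cᴴ + C * Cᴴ) := by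
      rw [hS]
      linear_combination (norm := noncomm_ring) hC * Cᴴ
    rw [h2, Matrix.trace_sub, Matrix.trace_sub, Matrix.trace_mul_comm C, sub_self, zero_sub,
      Matrix.trace_add]
  have h3 : (H * S).trace = ((Cᴴ * B)ᴴ * (Cᴴ * B)).trace + (Sᴴ * S).trace := by
    have h4 : H * S = B * (Bᴴ * C * Cᴴ) - B * (C * B)ᴴ * C + Sᴴ * S := by
      rw [hSH, Matrix.conjTranspose_mul, hH, hS]
      noncomm_ring
    rw [h4, hCB, Matrix.trace_add, Matrix.conjTranspose_zero, Matrix.mul_zero, Matrix.zero_mul,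
      sub_zero, Matrix.trace_mul_comm B, Matrix.conjTranspose_mul,
      Matrix.conjTranspose_conjTranspose, Matrix.mul_assoc (Bᴴ * C)]
  have h5 := (Matrix.posSemidef_conjTranspose_mul_self (Cᴴ * B)).trace_nonneg
  have h6 := (Matrix.posSemidef_conjTranspose_mul_self S).trace_nonneg
  have h7 := (Matrix.posSemidef_self_mul_conjTranspose C).trace_nonneg
  have h8 := add_nonneg h5 h6
  rw [← h3, h1, neg_nonneg] at h8
  exact le_antisymm ((le_add_of_nonneg_left h7).trans h8) h7

/-- Lowering operators on the two definite summands of an indefinite unitary representation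
of `sl₂`, linked by a raising operator `B`, vanish. -/
theorem lowering_pair_eq_zero {H K B C D : Matrix n n ℂ}
    (hH : H = B * Bᴴ + C * Cᴴ - Cᴴ * C) (hC : H * C = C * H - 2 * C)
    (hK : K = D * Dᴴ - Dᴴ * D - Bᴴ * B) (hD : K * D = D * K - 2 * D)
    (hB : H * B = B * K + 2 * B) (hCB : C * B = B * D) : C = 0 ∧ D = 0 := by
  have hKH : Kᴴ = K := by
    rw [hK]
    simp
  have hK' : -K = Bᴴ * Bᴴᴴ + Dᴴ * Dᴴᴴ - Dᴴᴴ * Dᴴ := by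
    rw [hK]
    simp only [Matrix.conjTranspose_conjTranspose]
    noncomm_ring
  have hD' : -K * Dᴴ = Dᴴ * -K - 2 * Dᴴ := by
    have h := congrArg Matrix.conjTranspose hD
    rw [two_mul] at h
    simp only [Matrix.conjTranspose_mul, Matrix.conjTranspose_sub, Matrix.conjTranspose_add,
      hKH] at h
    linear_combination (norm := noncomm_ring) h
  have h0 := lowering_mul_eq_zero hH hC hB (posSemidef_of_lowering hK' hD')
  refine ⟨lowering_eq_zero hH hC h0, ?_⟩
  rw [← Matrix.conjTranspose_eq_zero]
  refine lowering_eq_zero hK' hD' ?_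
  rw [← Matrix.conjTranspose_mul, ← hCB, h0, Matrix.conjTranspose_zero]

end LadderOperators

theorem eq_zero_of_skewHermitian_of_I_smul_sub {n : Type*} {A B : Matrix n n ℂ}
    (hA : Aᴴ = -A) (hB : Bᴴ = -B) (h : Complex.I • A - B = 0) : A = 0 ∧ B = 0 := by
  have h1 : Complex.I • A = B := sub_eq_zero.1 h
  have h2 := congrArg Matrix.conjTranspose h1
  simp only [Matrix.conjTranspose_smul, hA, hB, Complex.star_def, Complex.conj_I, neg_smul,
    smul_neg, neg_neg] at h2
  have h3 : B = 0 := by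
    ext i j
    exact self_eq_neg.1 (congrFun₂ (h1.symm.trans h2) i j)
  refine ⟨?_, h3⟩
  rw [h3] at h1
  exact (smul_eq_zero.1 h1).resolve_left Complex.I_ne_zero

theorem eq_fromBlocks_of_mem_su {p : ℕ} {M : Matrix (Fin p ⊕ Fin p) (Fin p ⊕ Fin p) ℂ}
    (hM : M ∈ su p p) :
    M = Matrix.fromBlocks M.toBlocks₁₁ M.toBlocks₁₂ M.toBlocks₁₂ᴴ M.toBlocks₂₂ ∧
      M.toBlocks₁₁ᴴ = -M.toBlocks₁₁ ∧ M.toBlocks₂₂ᴴ = -M.toBlocks₂₂ := by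
  have h := hM.1
  rw [← M.fromBlocks_toBlocks] at h
  simp only [Jpq, Matrix.fromBlocks_conjTranspose, Matrix.fromBlocks_multiply,
    Matrix.fromBlocks_add, ← Matrix.fromBlocks_zero, Matrix.fromBlocks_inj, Matrix.mul_one,
    Matrix.mul_zero, Matrix.zero_mul, Matrix.one_mul, Matrix.mul_neg, Matrix.neg_mul, add_zero,
    zero_add] at h
  obtain ⟨h₁₁, -, h₂₁, h₂₂⟩ := h
  refine ⟨?_, eq_neg_of_add_eq_zero_left h₁₁, ?_⟩
  · conv_lhs => rw [← M.fromBlocks_toBlocks]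
    rw [add_neg_eq_zero.1 h₂₁]
  · rw [← neg_add, neg_eq_zero] at h₂₂
    exact eq_neg_of_add_eq_zero_left h₂₂

theorem mem_su11_u : !![0, 1; 1, 0] ∈ su11 := by
  constructor
  · ext i j
    fin_cases i <;> fin_cases j <;> simp [Matrix.mul_apply]
  · simp [Matrix.trace]

theorem mem_su11_v : !![0, Complex.I; -Complex.I, 0] ∈ su11 := by
  constructor
  · ext i j
    fin_cases i <;> fin_cases j <;> simp [Matrix.mul_apply]
  · simp [Matrix.trace]

theorem mem_su11_w : !![Complex.I, 0; 0, -Complex.I] ∈ su11 := by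
  constructor
  · ext i j
    fin_cases i <;> fin_cases j <;> simp [Matrix.mul_apply]
  · simp [Matrix.trace]

theorem lie_w_u : ⁅!![Complex.I, 0; 0, -Complex.I], !![0, 1; 1, 0]⁆ =
    (2 : ℝ) • !![0, Complex.I; -Complex.I, 0] := by
  rw [Ring.lie_def]
  ext i j
  fin_cases i <;> fin_cases j <;> simp <;> ring

theorem lie_w_v : ⁅!![Complex.I, 0; 0, -Complex.I], !![0, Complex.I; -Complex.I, 0]⁆ =
    (-2 : ℝ) • (!![0, 1; 1, 0] : Matrix (Fin 2) (Fin 2) ℂ) := by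
  rw [Ring.lie_def]
  ext i j
  fin_cases i <;> fin_cases j <;> simp <;> ring

theorem lie_u_v : ⁅(!![0, 1; 1, 0] : Matrix (Fin 2) (Fin 2) ℂ), !![0, Complex.I; -Complex.I, 0]⁆ =
    (-2 : ℝ) • !![Complex.I, 0; 0, -Complex.I] := by
  rw [Ring.lie_def]
  ext i j
  fin_cases i <;> fin_cases j <;> simp <;> ring

/-- Every equivariant holomorphic embedding of the symmetric space of `SU(1,1)`
(the unit disc) into that of `SU(p,p)` is totally geodesic: an `ℝ`-linear,
bracket-preserving map `φ : su(1,1) → su(p,p)` whose differential is holomorphic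
(condition `hol`) and compatible with the maximal compact subgroups (conditions
`hw₁₂`, `hw₂₁`) sends the tangent part `p_H` of `su(1,1)` (spanned by `u`, `v`)
into the tangent part `p` of `su(p,p)` (the off-diagonal block matrices). -/
theorem equivariant_embedding_totally_geodesic
    (p : ℕ) (hp : 1 ≤ p)
    (φ : Matrix (Fin 2) (Fin 2) ℂ →ₗ[ℝ] Matrix (Fin p ⊕ Fin p) (Fin p ⊕ Fin p) ℂ)
    (hmem : ∀ M ∈ su11, φ M ∈ su p p)
    (hbrk : ∀ M ∈ su11, ∀ N ∈ su11, φ ⁅M, N⁆ = ⁅φ M, φ N⁆)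
    (hw₁₂ : (φ !![Complex.I, 0; 0, -Complex.I]).toBlocks₁₂ = 0)
    (hw₂₁ : (φ !![Complex.I, 0; 0, -Complex.I]).toBlocks₂₁ = 0)
    (hol : (φ !![0, Complex.I; -Complex.I, 0]).toBlocks₁₂
        = Complex.I • (φ !![0, 1; 1, 0]).toBlocks₁₂) :
    (φ !![0, 1; 1, 0]).toBlocks₁₁ = 0 ∧
    (φ !![0, 1; 1, 0]).toBlocks₂₂ = 0 ∧
    (φ !![0, Complex.I; -Complex.I, 0]).toBlocks₁₁ = 0 ∧
    (φ !![0, Complex.I; -Complex.I, 0]).toBlocks₂₂ = 0 := by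
  have hwu := hbrk _ mem_su11_w _ mem_su11_u
  have hwv := hbrk _ mem_su11_w _ mem_su11_v
  have huv := hbrk _ mem_su11_u _ mem_su11_v
  rw [lie_w_u, map_smul] at hwu
  rw [lie_w_v, map_smul] at hwv
  rw [lie_u_v, map_smul] at huv
  obtain ⟨hu, huA, huD⟩ := eq_fromBlocks_of_mem_su (hmem _ mem_su11_u)
  obtain ⟨hv, hvA, hvD⟩ := eq_fromBlocks_of_mem_su (hmem _ mem_su11_v)
  obtain ⟨hw, -, -⟩ := eq_fromBlocks_of_mem_su (hmem _ mem_su11_w)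
  rw [hol] at hv
  rw [hw₁₂] at hw
  generalize φ !![0, 1; 1, 0] = U at *
  generalize φ !![0, Complex.I; -Complex.I, 0] = V at *
  generalize φ !![Complex.I, 0; 0, -Complex.I] = W at *
  generalize U.toBlocks₁₁ = A at *
  generalize U.toBlocks₁₂ = B at *
  generalize U.toBlocks₂₂ = D at *
  generalize V.toBlocks₁₁ = A' at *
  generalize V.toBlocks₂₂ = D' at *
  generalize W.toBlocks₁₁ = P at *
  generalize W.toBlocks₂₂ = Q at *
  subst hu hv hw
  simp only [Ring.lie_def, Matrix.fromBlocks_multiply, Matrix.fromBlocks_smul,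
    sub_eq_add_neg, Matrix.fromBlocks_neg, Matrix.fromBlocks_add, Matrix.fromBlocks_inj,
    Matrix.conjTranspose_zero, Matrix.conjTranspose_smul, Complex.star_def, Complex.conj_I,
    Matrix.mul_zero, Matrix.zero_mul, add_zero, zero_add, Matrix.mul_smul, Matrix.smul_mul,
    ← Complex.coe_smul, Complex.ofReal_neg, Complex.ofReal_ofNat] at hwu hwv huv
  obtain ⟨hPA, hPB, -, hQD⟩ := hwu
  obtain ⟨hPA', -, -, hQD'⟩ := hwv
  obtain ⟨hP, hAB, -, hQ⟩ := huv
  have key := lowering_pair_eq_zero (H := -Complex.I • P) (K := -Complex.I • Q) (B := B)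
    (C := (2⁻¹ : ℂ) • (Complex.I • A - A')) (D := (2⁻¹ : ℂ) • (Complex.I • D - D'))
    ?_ ?_ ?_ ?_ ?_ ?_
  · obtain ⟨hC, hD⟩ := key
    have hE := (smul_eq_zero.1 hC).resolve_left (by norm_num)
    have hF := (smul_eq_zero.1 hD).resolve_left (by norm_num)
    obtain ⟨hA, hA'⟩ := eq_zero_of_skewHermitian_of_I_smul_sub huA hvA hE
    obtain ⟨hD, hD'⟩ := eq_zero_of_skewHermitian_of_I_smul_sub huD hvD hF
    exact ⟨hA, hD, hA', hD'⟩
  all_goals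
    simp only [two_mul, Matrix.conjTranspose_smul, Matrix.conjTranspose_sub, huA, hvA, huD, hvD,
      star_inv₀, star_ofNat, Matrix.mul_smul, Matrix.smul_mul,
      Matrix.mul_sub, Matrix.sub_mul, Matrix.mul_neg, Matrix.neg_mul, smul_sub, smul_neg,
      neg_smul, smul_smul]
  · linear_combination (norm := (match_scalars <;> ring_nf <;> simp <;> ring))
      (Complex.I / 2) • hP
  · linear_combination (norm := (match_scalars <;> ring_nf <;> simp))
      (-1 / 2 : ℂ) • hPA - (Complex.I / 2) • hPA'
  · linear_combination (norm := (match_scalars <;> ring_nf <;> simp <;> ring))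
      (Complex.I / 2) • hQ
  · linear_combination (norm := (match_scalars <;> ring_nf <;> simp))
      (-1 / 2 : ℂ) • hQD - (Complex.I / 2) • hQD'
  · linear_combination (norm := (match_scalars <;> ring_nf <;> simp))
      Complex.I • hPB
  · linear_combination (norm := (match_scalars <;> ring_nf))
      (-1 / 2 : ℂ) • hAB
end

section
/- Let p ≥ 1 and let E, F, Z be p×p complex matrices. Set X = fromBlocks E Z 0 F, Y = fromBlocks (-Eᴴ) 0 Zᴴ (-Fᴴ), and H = ⁅X, Y⁆. Assume Eᴴ * Z = Z * Fᴴ (so that H is block diagonal), ⁅H, X⁆ = 2•X, and ⁅H, Y⁆ = -2•Y. Then E = 0, F = 0, H = fromBlocks (Z*Zᴴ) 0 0 (-(Zᴴ*Z)), and Z*Zᴴ is idempotent: (Z*Zᴴ)*(Z*Zᴴ) = Z*Zᴴ (equivalently, Z*Zᴴ is the matrix of an orthogonal projection). -/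
open Matrix

open scoped ComplexOrder

/-- In a finite-dimensional representation, every eigenvalue of the semisimple element of an
`sl₂` triple is an integer. -/
theorem IsSl2Triple.exists_int_of_lie_h_eq_smul {R L M : Type*} [CommRing R] [LieRing L]
    [LieAlgebra R L] [AddCommGroup M] [Module R M] [LieRingModule L M] [LieModule R L M]
    [IsNoetherian R M] [Module.IsTorsionFree R M] [IsDomain R] [CharZero R]
    {h e f : L} (t : IsSl2Triple h e f) {m : M} {μ : R} (hm : m ≠ 0) (hμ : ⁅h, m⁆ = μ • m) :
    ∃ z : ℤ, μ = z := by
  have lie_h_pow (n : ℕ) : ⁅h, (LieModule.toEnd R L M e ^ n) m⁆ =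
      (μ + 2 * n) • (LieModule.toEnd R L M e ^ n) m := by
    induction n with
    | zero => simpa using hμ
    | succ n ih =>
      rw [pow_succ', Module.End.mul_apply, LieModule.toEnd_apply_apply, leibniz_lie h,
        t.lie_h_e_smul R, ih, lie_smul, smul_lie, ← add_smul]
      congr 1
      push_cast
      ring
  have exists_pow_eq_zero : ∃ n : ℕ, (LieModule.toEnd R L M e ^ n) m = 0 := by
    by_contra! hne
    have hs : (Set.range fun n : ℕ ↦ μ + 2 * (n : R)).Infinite :=
      Set.infinite_range_of_injective fun a b hab ↦ by simpa using hab
    refine hs ((LieModule.toEnd R L M h).eigenvectors_linearIndependent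
      (Set.range fun n : ℕ ↦ μ + 2 * (n : R))
      (fun r ↦ (LieModule.toEnd R L M e ^ Classical.choose r.2) m)
      (fun r ↦ ?_)).finite
    have hr : μ + 2 * ((Classical.choose r.2 : ℕ) : R) = r := Classical.choose_spec r.2
    exact ⟨Module.End.mem_eigenspace_iff.mpr
      ((lie_h_pow _).trans (congrArg (· • _) hr)), hne _⟩
  obtain ⟨n, hn, hn'⟩ :=
    Nat.exists_not_and_succ_of_not_zero_of_exists (by simpa using hm) exists_pow_eq_zero
  have P : t.HasPrimitiveVectorWith ((LieModule.toEnd R L M e ^ n) m) (μ + 2 * n) :=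
    ⟨hn, lie_h_pow n, by simpa [pow_succ'] using hn'⟩
  obtain ⟨k, hk⟩ := P.exists_nat
  exact ⟨k - 2 * n, by push_cast; linear_combination hk⟩

/-- A Hermitian matrix all of whose eigenvalues are integers satisfies `A ≤ A * A`. -/
theorem Matrix.IsHermitian.posSemidef_mul_self_sub_self {n : Type*} [Fintype n] [DecidableEq n]
    {A : Matrix n n ℂ} (hA : A.IsHermitian)
    (hint : ∀ (v : n → ℂ) (μ : ℂ), v ≠ 0 → A *ᵥ v = μ • v → ∃ z : ℤ, μ = z) :
    (A * A - A).PosSemidef := by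
  have hev (i : n) : 0 ≤ hA.eigenvalues i * hA.eigenvalues i - hA.eigenvalues i := by
    obtain ⟨z, hz⟩ := hint (hA.eigenvectorBasis i) (hA.eigenvalues i)
      ((WithLp.ofLp_eq_zero 2).ne.2 <| hA.eigenvectorBasis.orthonormal.ne_zero i)
      (by simpa using hA.mulVec_eigenvectorBasis i)
    have hz' : hA.eigenvalues i = z := by exact_mod_cast hz
    rw [hz', sub_nonneg]
    exact_mod_cast (Int.le_self_sq z).trans_eq (sq z)
  have hdiag : (diagonal fun i ↦
      ((hA.eigenvalues i * hA.eigenvalues i - hA.eigenvalues i : ℝ) : ℂ)).PosSemidef :=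
    PosSemidef.diagonal fun i ↦ Complex.zero_le_real.mpr (hev i)
  have hconj : A * A - A = Unitary.conjStarAlgAut ℂ _ hA.eigenvectorUnitary
      (diagonal fun i ↦ ((hA.eigenvalues i * hA.eigenvalues i - hA.eigenvalues i : ℝ) : ℂ)) := by
    conv_lhs => rw [hA.spectral_theorem]
    rw [← map_mul, ← map_sub, diagonal_mul_diagonal, diagonal_sub]
    simp
  rw [hconj, Unitary.conjStarAlgAut_apply]
  exact hdiag.mul_mul_conjTranspose_same _

/-- The eigenvalues of the semisimple element of an `sl₂` triple of complex matrices are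
integers. -/
theorem Matrix.exists_int_of_mulVec_eq_smul {n : Type*} [Fintype n] [DecidableEq n]
    {H X Y : Matrix n n ℂ} (hH : H = ⁅X, Y⁆) (hHX : ⁅H, X⁆ = (2 : ℂ) • X)
    (hHY : ⁅H, Y⁆ = (-2 : ℂ) • Y) {v : n → ℂ} {μ : ℂ} (hv : v ≠ 0) (hμ : H *ᵥ v = μ • v) :
    ∃ z : ℤ, μ = z := by
  by_cases h0 : H = 0
  · refine ⟨0, ?_⟩
    rw [h0, zero_mulVec, eq_comm, smul_eq_zero_iff_left hv] at hμ
    simpa using hμ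
  · let _ : LieRing (Matrix n n ℂ) := LieRing.ofAssociativeRing
    have t : IsSl2Triple H X Y :=
      ⟨h0, hH.symm, by rw [hHX, two_smul, two_smul], by rw [hHY, neg_smul, two_smul, two_smul]⟩
    exact t.exists_int_of_lie_h_eq_smul hv hμ

/-- If `X = fromBlocks E Z 0 F`, `Y = fromBlocks (-Eᴴ) 0 Zᴴ (-Fᴴ)` and
`H = ⁅X,Y⁆` form an `sl₂`-triple (with `H` block diagonal, which is ensured by
`Eᴴ * Z = Z * Fᴴ`), then `E = 0`, `F = 0`,
`H = fromBlocks (Z*Zᴴ) 0 0 (-(Zᴴ*Z))`, and `Z*Zᴴ` is an orthogonal projection. -/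
theorem sl2_triple_blocks_vanish
    (p : ℕ) (hp : 1 ≤ p)
    (E F Z : Matrix (Fin p) (Fin p) ℂ)
    (X Y H : Matrix (Fin p ⊕ Fin p) (Fin p ⊕ Fin p) ℂ)
    (hX : X = Matrix.fromBlocks E Z 0 F)
    (hY : Y = Matrix.fromBlocks (-Eᴴ) 0 Zᴴ (-Fᴴ))
    (hH : H = ⁅X, Y⁆)
    (hEZ : Eᴴ * Z = Z * Fᴴ)
    (hHX : ⁅H, X⁆ = (2 : ℂ) • X)
    (hHY : ⁅H, Y⁆ = (-2 : ℂ) • Y) :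
    E = 0 ∧ F = 0 ∧
    H = Matrix.fromBlocks (Z * Zᴴ) 0 0 (-(Zᴴ * Z)) ∧
    (Z * Zᴴ) * (Z * Zᴴ) = Z * Zᴴ := by
  have hZE : Zᴴ * E = F * Zᴴ := by simpa using congrArg conjTranspose hEZ
  obtain ⟨A, hA⟩ : ∃ A, A = Z * Zᴴ - E * Eᴴ + Eᴴ * E := ⟨_, rfl⟩
  obtain ⟨D, hD⟩ : ∃ D, D = Fᴴ * F - F * Fᴴ - Zᴴ * Z := ⟨_, rfl⟩
  have hblocks : H = fromBlocks A 0 0 D := by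
    rw [hH, hX, hY, Ring.lie_def, fromBlocks_multiply, fromBlocks_multiply, sub_eq_add_neg,
      fromBlocks_neg, fromBlocks_add, fromBlocks_inj, hA, hD]
    simp only [mul_neg, neg_mul, mul_zero, zero_mul, hEZ, hZE]
    refine ⟨?_, ?_, ?_, ?_⟩ <;> abel
  have hA_herm : A.IsHermitian := by
    simp [IsHermitian, hA]
  have hD_herm : D.IsHermitian := by
    simp [IsHermitian, hD]
  have hA_pos : (A * A - A).PosSemidef :=
    hA_herm.posSemidef_mul_self_sub_self fun v μ hv hμ ↦
      exists_int_of_mulVec_eq_smul hH hHX hHY (v := Sum.elim v 0)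
        (fun h ↦ hv (funext fun i ↦ congrFun h (Sum.inl i)))
        (by ext (i | i) <;> simp [hblocks, fromBlocks_mulVec, hμ])
  have hD_pos : (D * D + D).PosSemidef := by
    have := hD_herm.neg.posSemidef_mul_self_sub_self fun v μ hv hμ ↦ by
      obtain ⟨z, hz⟩ := exists_int_of_mulVec_eq_smul hH hHX hHY (v := Sum.elim 0 v) (μ := -μ)
        (fun h ↦ hv (funext fun i ↦ congrFun h (Sum.inr i)))
        (by
          rw [neg_mulVec, neg_eq_iff_eq_neg] at hμ
          ext (i | i) <;> simp [hblocks, fromBlocks_mulVec, hμ])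
      exact ⟨-z, by push_cast; linear_combination -hz⟩
    simpa using this
  obtain ⟨hAE, hAZ, -, hDF⟩ : A * E - E * A = (2 : ℂ) • E ∧ A * Z - Z * D = (2 : ℂ) • Z ∧
      (0 : Matrix (Fin p) (Fin p) ℂ) = 0 ∧ D * F - F * D = (2 : ℂ) • F := by
    simpa [hX, hblocks, Ring.lie_def, fromBlocks_multiply, sub_eq_add_neg, fromBlocks_neg,
      fromBlocks_add, fromBlocks_smul, fromBlocks_inj] using hHX
  have trE : (A * (Z * Zᴴ)).trace - (A * A).trace = 2 * (E * Eᴴ).trace := by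
    have h := congrArg (fun M ↦ (M * Eᴴ).trace) hAE
    have h' : (A * A).trace = (A * (Z * Zᴴ - E * Eᴴ + Eᴴ * E)).trace := by rw [← hA]
    simp only [sub_mul, mul_add, mul_sub, trace_sub, trace_add, smul_mul_assoc, trace_smul,
      smul_eq_mul, Matrix.mul_assoc] at h h'
    rw [trace_mul_comm E, Matrix.mul_assoc] at h
    linear_combination h - h'
  have trF : -(D * (Zᴴ * Z)).trace - (D * D).trace = 2 * (F * Fᴴ).trace := by
    have h := congrArg (fun M ↦ (M * Fᴴ).trace) hDF
    have h' : (D * D).trace = (D * (Fᴴ * F - F * Fᴴ - Zᴴ * Z)).trace := by rw [← hD]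
    simp only [sub_mul, mul_sub, trace_sub, smul_mul_assoc, trace_smul,
      smul_eq_mul, Matrix.mul_assoc] at h h'
    rw [trace_mul_comm F, Matrix.mul_assoc] at h
    linear_combination h - h'
  have trZ : (A * (Z * Zᴴ)).trace - (D * (Zᴴ * Z)).trace = 2 * (Z * Zᴴ).trace := by
    have h := congrArg (fun M ↦ (M * Zᴴ).trace) hAZ
    simp only [sub_mul, trace_sub, smul_mul_assoc, trace_smul, smul_eq_mul, Matrix.mul_assoc] at h
    rwa [trace_mul_comm Z, Matrix.mul_assoc] at h
  have trA : A.trace = (Z * Zᴴ).trace := by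
    rw [hA, trace_add, trace_sub, trace_mul_comm E]; ring
  have trD : D.trace = -(Z * Zᴴ).trace := by
    rw [hD, trace_sub, trace_sub, trace_mul_comm F, trace_mul_comm Z]; ring
  have hsum : (A * A - A).trace + (D * D + D).trace + 2 * (E * Eᴴ).trace + 2 * (F * Fᴴ).trace
      = 0 := by
    rw [trace_sub, trace_add]
    linear_combination -trE - trF + trZ - trA + trD
  have nnA := hA_pos.trace_nonneg
  have nnD := hD_pos.trace_nonneg
  have nnE : 0 ≤ 2 * (E * Eᴴ).trace :=
    mul_nonneg zero_le_two (posSemidef_self_mul_conjTranspose E).trace_nonneg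
  have nnF : 0 ≤ 2 * (F * Fᴴ).trace :=
    mul_nonneg zero_le_two (posSemidef_self_mul_conjTranspose F).trace_nonneg
  rw [add_eq_zero_iff_of_nonneg (add_nonneg (add_nonneg nnA nnD) nnE) nnF,
    add_eq_zero_iff_of_nonneg (add_nonneg nnA nnD) nnE, add_eq_zero_iff_of_nonneg nnA nnD] at hsum
  obtain ⟨⟨⟨hA0, -⟩, hE0⟩, hF0⟩ := hsum
  have hE : E = 0 := by simpa [trace_mul_conjTranspose_self_eq_zero_iff] using hE0
  have hF : F = 0 := by simpa [trace_mul_conjTranspose_self_eq_zero_iff] using hF0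
  have hA' : A = Z * Zᴴ := by simp [hA, hE]
  refine ⟨hE, hF, ?_, ?_⟩
  · simp [hblocks, hA', hD, hF]
  · rw [← hA']
    exact sub_eq_zero.mp (hA_pos.trace_eq_zero_iff.mp hA0)
end

section
/- Let p ≥ 1 and let E, F, Z be p×p complex matrices. Set X = fromBlocks E Z 0 F, Y = fromBlocks (-Eᴴ) 0 Zᴴ (-Fᴴ), and H = ⁅X, Y⁆. Assume Eᴴ * Z = Z * Fᴴ, ⁅H, X⁆ = 2•X, ⁅H, Y⁆ = -2•Y, and that every complex eigenvalue of H (every root of its characteristic polynomial) is an odd integer. Then E = 0, F = 0, Z is unitary (Z*Zᴴ = 1 and Zᴴ*Z = 1), and H = fromBlocks 1 0 0 (-1). (In particular the associated representation of sl(2) is a multiple of the standard two-dimensional representation, in conformity with Satake's results.) -/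
open Matrix

open scoped ComplexOrder

/-- If `A = Z Zᴴ - E Eᴴ + Eᴴ E`, then `⟨v, A v⟩ = ‖Zᴴ v‖² - ‖Eᴴ v‖² + ‖E v‖²`. -/
theorem star_dotProduct_mulVec_eq {n : Type*} [Fintype n] {A E Z : Matrix n n ℂ}
    (hA : A = Z * Zᴴ - E * Eᴴ + Eᴴ * E) (v : n → ℂ) :
    star v ⬝ᵥ (A *ᵥ v) = star (Zᴴ *ᵥ v) ⬝ᵥ (Zᴴ *ᵥ v) - star (Eᴴ *ᵥ v) ⬝ᵥ (Eᴴ *ᵥ v)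
      + star (E *ᵥ v) ⬝ᵥ (E *ᵥ v) := by
  have key (M : Matrix n n ℂ) : star v ⬝ᵥ ((Mᴴ * M) *ᵥ v) = star (M *ᵥ v) ⬝ᵥ (M *ᵥ v) := by
    rw [star_mulVec, ← dotProduct_mulVec, mulVec_mulVec]
  have hZ := key Zᴴ
  have hE := key Eᴴ
  rw [conjTranspose_conjTranspose] at hZ hE
  rw [hA, add_mulVec, sub_mulVec, dotProduct_add, dotProduct_sub, hZ, hE, key]

theorem Matrix.IsHermitian.exists_eigenvalues_eq {n : Type*} [Fintype n] [DecidableEq n]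
    {A : Matrix n n ℂ} (hA : A.IsHermitian) {w : n → ℂ} (hw : w ≠ 0) {c : ℝ}
    (h : A *ᵥ w = (c : ℂ) • w) : ∃ i, hA.eigenvalues i = c := by
  have h1 : Module.End.HasEigenvalue (Matrix.toLin' A) (c : ℂ) :=
    Module.End.hasEigenvalue_of_hasEigenvector
      ⟨Module.End.mem_eigenspace_iff.2 (by simpa using h), hw⟩
  have h2 : (c : ℂ) ∈ spectrum ℂ A := by
    simpa [Matrix.spectrum_toLin'] using h1.mem_spectrum
  rw [hA.spectrum_eq_image_range] at h2
  obtain ⟨_, ⟨i, rfl⟩, hi⟩ := h2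
  exact ⟨i, Complex.ofReal_injective hi⟩

theorem Matrix.IsHermitian.exists_eigenvector {n : Type*} [Fintype n] [DecidableEq n]
    {A : Matrix n n ℂ} (hA : A.IsHermitian) (i : n) :
    ∃ v : n → ℂ, v ≠ 0 ∧ A *ᵥ v = (hA.eigenvalues i : ℂ) • v := by
  refine ⟨hA.eigenvectorBasis i, fun h => ?_, ?_⟩
  · exact hA.eigenvectorBasis.toBasis.ne_zero i (by
      rw [OrthonormalBasis.coe_toBasis]; ext j; exact congrFun h j)
  · simpa using hA.mulVec_eigenvectorBasis i

theorem nonneg_of_mul_star_dotProduct_nonneg {n : Type*} [Fintype n] {v : n → ℂ} (hv : v ≠ 0)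
    {c : ℝ} (h : 0 ≤ (c : ℂ) * (star v ⬝ᵥ v)) : 0 ≤ c := by
  have h1 := (Complex.le_def.1 h).1
  rw [Complex.zero_re, Complex.re_ofReal_mul] at h1
  exact nonneg_of_mul_nonneg_left h1 (Complex.pos_iff.1 (dotProduct_star_self_pos_iff.2 hv)).1

/-- The lowest weight argument: the least eigenvalue of `A` is nonnegative. -/
theorem eigenvalues_nonneg_of_ladder {n : Type*} [Fintype n] [DecidableEq n]
    {A E Z : Matrix n n ℂ} (hH : A.IsHermitian) (hA : A = Z * Zᴴ - E * Eᴴ + Eᴴ * E)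
    (hAE : A * Eᴴ - Eᴴ * A = (-2 : ℂ) • Eᴴ) (j : n) : 0 ≤ hH.eigenvalues j := by
  have : Nonempty n := ⟨j⟩
  obtain ⟨i, hi⟩ := Finite.exists_min hH.eigenvalues
  obtain ⟨v, hv, hAv⟩ := hH.exists_eigenvector i
  refine le_trans ?_ (hi j)
  have h0 : Eᴴ *ᵥ v = 0 := by
    by_contra hne
    obtain ⟨k, hk⟩ := hH.exists_eigenvalues_eq hne (c := hH.eigenvalues i - 2) (by
      rw [mulVec_mulVec, sub_eq_iff_eq_add.1 hAE, add_mulVec, ← mulVec_mulVec, hAv, mulVec_smul,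
        smul_mulVec, ← add_smul]
      congr 1; push_cast; ring)
    linarith [hi k]
  have h1 := star_dotProduct_mulVec_eq hA v
  rw [hAv, h0, dotProduct_smul, dotProduct_zero, sub_zero, smul_eq_mul] at h1
  refine nonneg_of_mul_star_dotProduct_nonneg hv ?_
  rw [h1]
  exact add_nonneg (dotProduct_star_self_nonneg _) (dotProduct_star_self_nonneg _)

/-- The highest weight argument: the greatest eigenvalue of `A` is at most one. -/
theorem eigenvalues_le_one_of_ladder {n : Type*} [Fintype n] [DecidableEq n]
    {A B E Z : Matrix n n ℂ} (hH : A.IsHermitian) (hB : B.IsHermitian)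
    (hA : A = Z * Zᴴ - E * Eᴴ + Eᴴ * E)
    (hAE : A * E - E * A = (2 : ℂ) • E) (hZ : Zᴴ * A + B * Zᴴ = (2 : ℂ) • Zᴴ)
    (hB1 : ∀ i, 1 ≤ hB.eigenvalues i) (j : n) : hH.eigenvalues j ≤ 1 := by
  have : Nonempty n := ⟨j⟩
  obtain ⟨i, hi⟩ := Finite.exists_max hH.eigenvalues
  obtain ⟨v, hv, hAv⟩ := hH.exists_eigenvector i
  refine (hi j).trans ?_
  have h0 : E *ᵥ v = 0 := by
    by_contra hne
    obtain ⟨k, hk⟩ := hH.exists_eigenvalues_eq hne (c := hH.eigenvalues i + 2) (by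
      rw [mulVec_mulVec, sub_eq_iff_eq_add.1 hAE, add_mulVec, ← mulVec_mulVec, hAv, mulVec_smul,
        smul_mulVec, ← add_smul]
      congr 1; push_cast; ring)
    linarith [hi k]
  by_cases hne : Zᴴ *ᵥ v = 0
  · have h1 := star_dotProduct_mulVec_eq hA v
    rw [hAv, h0, hne, dotProduct_smul, dotProduct_zero, add_zero, zero_sub,
      smul_eq_mul] at h1
    have h2 : 0 ≤ -hH.eigenvalues i := nonneg_of_mul_star_dotProduct_nonneg hv (by
      rw [Complex.ofReal_neg, neg_mul, h1, neg_neg]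
      exact dotProduct_star_self_nonneg _)
    linarith
  · obtain ⟨k, hk⟩ := hB.exists_eigenvalues_eq hne (c := 2 - hH.eigenvalues i) (by
      rw [mulVec_mulVec, eq_sub_of_add_eq' hZ, sub_mulVec, ← mulVec_mulVec, hAv, mulVec_smul,
        smul_mulVec, ← sub_smul]
      congr 1; push_cast; ring)
    linarith [hB1 k]

theorem Matrix.IsHermitian.eq_one_of_eigenvalues {n : Type*} [Fintype n] [DecidableEq n]
    {A : Matrix n n ℂ} (hA : A.IsHermitian) (h : ∀ i, hA.eigenvalues i = 1) : A = 1 := by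
  have hd : diagonal ((RCLike.ofReal : ℝ → ℂ) ∘ hA.eigenvalues) = 1 := by
    rw [← diagonal_one]; congr 1; ext i; simp [h]
  rw [hA.spectral_theorem, hd, map_one]

theorem Matrix.isRoot_charpoly_of_mulVec {n : Type*} [Fintype n] [DecidableEq n]
    {M : Matrix n n ℂ} {w : n → ℂ} (hw : w ≠ 0) {μ : ℂ} (h : M *ᵥ w = μ • w) :
    M.charpoly.IsRoot μ := by
  rw [← Matrix.charpoly_toLin', ← Module.End.hasEigenvalue_iff_isRoot_charpoly]
  exact Module.End.hasEigenvalue_of_hasEigenvector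
    ⟨Module.End.mem_eigenspace_iff.2 (by simpa using h), hw⟩

theorem one_le_of_nonneg_of_odd {c : ℝ} (hc : 0 ≤ c) {k : ℤ} (hk : Odd k) (h : c = k) :
    1 ≤ c := by
  subst h
  have h1 : 0 ≤ k := by exact_mod_cast hc
  have h2 : k ≠ 0 := by rintro rfl; simp at hk
  exact_mod_cast (show 1 ≤ k by omega)

/-- If `X = fromBlocks E Z 0 F`, `Y = fromBlocks (-Eᴴ) 0 Zᴴ (-Fᴴ)` and
`H = ⁅X,Y⁆` form an `sl₂`-triple with `Eᴴ * Z = Z * Fᴴ`, and every complex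
eigenvalue of `H` (every root of its characteristic polynomial) is an odd
integer, then `E = 0`, `F = 0`, `Z` is unitary, and `H = fromBlocks 1 0 0 (-1)`:
the associated representation of `sl(2)` is a multiple of the standard
two-dimensional representation, in conformity with Satake's results. -/
theorem sl2_triple_odd_eigenvalues
    (p : ℕ) (hp : 1 ≤ p)
    (E F Z : Matrix (Fin p) (Fin p) ℂ)
    (X Y H : Matrix (Fin p ⊕ Fin p) (Fin p ⊕ Fin p) ℂ)
    (hX : X = Matrix.fromBlocks E Z 0 F)
    (hY : Y = Matrix.fromBlocks (-Eᴴ) 0 Zᴴ (-Fᴴ))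
    (hH : H = ⁅X, Y⁆)
    (hEZ : Eᴴ * Z = Z * Fᴴ)
    (hHX : ⁅H, X⁆ = (2 : ℂ) • X)
    (hHY : ⁅H, Y⁆ = (-2 : ℂ) • Y)
    (hodd : ∀ μ : ℂ, (Matrix.charpoly H).IsRoot μ → ∃ k : ℤ, Odd k ∧ μ = (k : ℂ)) :
    E = 0 ∧ F = 0 ∧ Z * Zᴴ = 1 ∧ Zᴴ * Z = 1 ∧
    H = Matrix.fromBlocks 1 0 0 (-1) := by
  set A := Z * Zᴴ - E * Eᴴ + Eᴴ * E with hA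
  set B := Zᴴ * Z - Fᴴ * F + F * Fᴴ with hB
  have hZE : Zᴴ * E = F * Zᴴ := by
    simpa [conjTranspose_mul] using congrArg conjTranspose hEZ
  have hHAB : H = fromBlocks A 0 0 (-B) := by
    rw [hH, hX, hY, Ring.lie_def, fromBlocks_multiply, fromBlocks_multiply, sub_eq_add_neg,
      fromBlocks_neg, fromBlocks_add, fromBlocks_inj]
    refine ⟨?_, ?_, ?_, ?_⟩
    · rw [hA]; simp; abel
    · simp [hEZ]
    · simp [hZE]
    · rw [hB]; simp; abel
  have hAH : A.IsHermitian := by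
    simp only [IsHermitian, hA, conjTranspose_add, conjTranspose_sub, conjTranspose_mul,
      conjTranspose_conjTranspose]
  have hBH : B.IsHermitian := by
    simp only [IsHermitian, hB, conjTranspose_add, conjTranspose_sub, conjTranspose_mul,
      conjTranspose_conjTranspose]
  have hB' : B = Zᴴ * Zᴴᴴ - Fᴴ * Fᴴᴴ + Fᴴᴴ * Fᴴ := by simp [hB]
  rw [hHAB, hX, Ring.lie_def, fromBlocks_multiply, fromBlocks_multiply, sub_eq_add_neg,
    fromBlocks_neg, fromBlocks_add, fromBlocks_smul, fromBlocks_inj] at hHX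
  rw [hHAB, hY, Ring.lie_def, fromBlocks_multiply, fromBlocks_multiply, sub_eq_add_neg,
    fromBlocks_neg, fromBlocks_add, fromBlocks_smul, fromBlocks_inj] at hHY
  obtain ⟨hAE, hAZ, -, hBF⟩ := hHX
  obtain ⟨hAE', -, hBZ, hBF'⟩ := hHY
  simp only [mul_zero, zero_mul, add_zero, zero_add, mul_neg, neg_mul, neg_neg, smul_neg]
    at hAE hAZ hBF hAE' hBZ hBF'
  have hAE₁ : A * E - E * A = (2 : ℂ) • E := by rw [← hAE]; abel
  have hAE₂ : A * Eᴴ - Eᴴ * A = (-2 : ℂ) • Eᴴ := by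
    rw [← neg_inj, ← hAE']; abel
  have hBF₁ : B * Fᴴ - Fᴴ * B = (2 : ℂ) • Fᴴ := by
    rw [← neg_neg ((2 : ℂ) • Fᴴ), ← neg_smul, ← hBF']; abel
  have hBF₂ : B * Fᴴᴴ - Fᴴᴴ * B = (-2 : ℂ) • Fᴴᴴ := by
    rw [conjTranspose_conjTranspose, neg_smul, ← hBF]; abel
  have hZ₁ : Zᴴ * A + B * Zᴴ = (2 : ℂ) • Zᴴ := by
    rw [← neg_neg ((2 : ℂ) • Zᴴ), ← neg_smul, ← hBZ]; abel
  have hZ₂ : Zᴴᴴ * B + A * Zᴴᴴ = (2 : ℂ) • Zᴴᴴ := by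
    rw [conjTranspose_conjTranspose, ← hAZ]; abel
  have hA1 (i) : 1 ≤ hAH.eigenvalues i := by
    obtain ⟨v, hv, hAv⟩ := hAH.exists_eigenvector i
    obtain ⟨k, hk, hki⟩ := hodd (hAH.eigenvalues i)
      (isRoot_charpoly_of_mulVec (w := Sum.elim v 0)
        (fun h => hv (funext fun j => congrFun h (Sum.inl j))) (by
          rw [hHAB, fromBlocks_mulVec]
          ext (j | j) <;> simp [hAv]))
    exact one_le_of_nonneg_of_odd (eigenvalues_nonneg_of_ladder hAH hA hAE₂ i) hk
      (by exact_mod_cast hki)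
  have hB1 (i) : 1 ≤ hBH.eigenvalues i := by
    obtain ⟨v, hv, hBv⟩ := hBH.exists_eigenvector i
    obtain ⟨k, hk, hki⟩ := hodd (-hBH.eigenvalues i)
      (isRoot_charpoly_of_mulVec (w := Sum.elim 0 v)
        (fun h => hv (funext fun j => congrFun h (Sum.inr j))) (by
          rw [hHAB, fromBlocks_mulVec]
          ext (j | j) <;> simp [hBv, neg_mulVec]))
    exact one_le_of_nonneg_of_odd (eigenvalues_nonneg_of_ladder hBH hB' hBF₂ i) hk.neg
      (by rw [Int.cast_neg, ← neg_eq_iff_eq_neg]; exact_mod_cast hki)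
  have hAone : A = 1 := hAH.eq_one_of_eigenvalues fun i =>
    (eigenvalues_le_one_of_ladder hAH hBH hA hAE₁ hZ₁ hB1 i).antisymm (hA1 i)
  have hBone : B = 1 := hBH.eq_one_of_eigenvalues fun i =>
    (eigenvalues_le_one_of_ladder hBH hAH hB' hBF₁ hZ₂ hA1 i).antisymm (hB1 i)
  have hE0 : E = 0 := by simpa [hAone] using hAE₁.symm
  have hF0 : F = 0 := by simpa [hBone] using hBF₁.symm
  refine ⟨hE0, hF0, ?_, ?_, by rw [hHAB, hAone, hBone]⟩
  · simpa [hE0] using hA.symm.trans hAone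
  · simpa [hF0] using hB.symm.trans hBone
end

section
/- Let p ≥ 1 and let E, F, Z be p×p complex matrices. Set X = fromBlocks E Z 0 F, Y = fromBlocks (-Eᴴ) 0 Zᴴ (-Fᴴ), and H = ⁅X, Y⁆. Assume Eᴴ * Z = Z * Fᴴ, ⁅H, X⁆ = 2•X, ⁅H, Y⁆ = -2•Y, and that every complex eigenvalue of H (every root of its characteristic polynomial) is an even integer. Then E = 0, F = 0, Z = 0, hence X = 0, Y = 0 and H = 0 (the representation of sl(2) on the even part of the eigenspace decomposition is trivial). -/
open Matrix

namespace Sl2Blocks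

/-- The roots of the characteristic polynomial are the eigenvalues. -/
lemma isRoot_charpoly_iff {ι : Type*} [Fintype ι] [DecidableEq ι] (M : Matrix ι ι ℂ) (μ : ℂ) :
    M.charpoly.IsRoot μ ↔ ∃ v, v ≠ 0 ∧ M *ᵥ v = μ • v := by
  rw [Polynomial.IsRoot, Matrix.eval_charpoly, ← Matrix.exists_mulVec_eq_zero_iff]
  refine exists_congr fun v ↦ and_congr_right fun _ ↦ ?_
  rw [Matrix.sub_mulVec, sub_eq_zero, eq_comm]
  simp

section Strings

variable {ι : Type*} [Fintype ι] {X Y H J : Matrix ι ι ℂ}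

/-- A matrix that raises weights by `c` maps the `μ`-eigenspace into the `(μ + c)`-eigenspace. -/
lemma mulVec_weight {c μ : ℂ} (h : H * X - X * H = c • X) {v : ι → ℂ} (hv : H *ᵥ v = μ • v) :
    H *ᵥ (X *ᵥ v) = (μ + c) • (X *ᵥ v) := by
  have h' : H * X = X * H + c • X := by rw [← h]; abel
  rw [Matrix.mulVec_mulVec, h', Matrix.add_mulVec, ← Matrix.mulVec_mulVec, hv, Matrix.mulVec_smul,
    Matrix.smul_mulVec, add_smul]

/-- If `-Y` is the `J`-adjoint of `X`, then `X` moves across the form of `J`. -/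
lemma form_mulVec (hJ : Xᴴ * J = -(J * Y)) (u v : ι → ℂ) :
    star (X *ᵥ u) ⬝ᵥ (J *ᵥ v) = -(star u ⬝ᵥ (J *ᵥ (Y *ᵥ v))) := by
  rw [Matrix.star_mulVec, ← Matrix.dotProduct_mulVec, Matrix.mulVec_mulVec, hJ, Matrix.neg_mulVec,
    dotProduct_neg, Matrix.mulVec_mulVec]

variable [DecidableEq ι]

lemma mulVec_weight_pow (h : H * X - X * H = (2 : ℂ) • X) {μ : ℂ} {v : ι → ℂ}
    (hv : H *ᵥ v = μ • v) (k : ℕ) : H *ᵥ (X ^ k *ᵥ v) = (μ + 2 * k) • (X ^ k *ᵥ v) := by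
  induction k with
  | zero => simpa using hv
  | succ k ih =>
    rw [pow_succ', ← Matrix.mulVec_mulVec, mulVec_weight h ih]
    push_cast
    ring_nf

/-- The lowering matrix on the string through a lowest weight vector of weight `-n`. -/
lemma lower_mulVec_pow (hXY : X * Y - Y * X = H) (h : H * X - X * H = (2 : ℂ) • X) {n : ℂ}
    {v : ι → ℂ} (hv : H *ᵥ v = (-n) • v) (hYv : Y *ᵥ v = 0) (k : ℕ) :
    Y *ᵥ (X ^ (k + 1) *ᵥ v) = ((k + 1) * (n - k)) • (X ^ k *ᵥ v) := by
  have hYX : Y * X = X * Y - H := by rw [← hXY]; abel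
  induction k with
  | zero =>
    rw [zero_add, pow_one, Matrix.mulVec_mulVec, hYX, Matrix.sub_mulVec, ← Matrix.mulVec_mulVec,
      hYv, hv]
    simp
  | succ k ih =>
    rw [pow_succ' X (k + 1), ← Matrix.mulVec_mulVec, Matrix.mulVec_mulVec, hYX, Matrix.sub_mulVec,
      ← Matrix.mulVec_mulVec, ih, mulVec_weight_pow h hv, Matrix.mulVec_smul,
      Matrix.mulVec_mulVec, ← pow_succ', ← sub_smul]
    push_cast
    ring_nf

/-- Along the string through a lowest weight vector of weight `-n`, the sign of the `J`-form
alternates. -/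
lemma exists_form_pow (hXY : X * Y - Y * X = H) (h : H * X - X * H = (2 : ℂ) • X)
    (hJ : Xᴴ * J = -(J * Y)) {n : ℕ}
    {v : ι → ℂ} (hv : H *ᵥ v = (-n : ℂ) • v) (hYv : Y *ᵥ v = 0) (k : ℕ) (hk : k ≤ n) :
    ∃ c : ℝ, 0 < c ∧ star (X ^ k *ᵥ v) ⬝ᵥ (J *ᵥ (X ^ k *ᵥ v)) =
      ((-1) ^ k * c : ℝ) * (star v ⬝ᵥ (J *ᵥ v)) := by
  induction k with
  | zero => exact ⟨1, one_pos, by simp⟩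
  | succ k ih =>
    obtain ⟨c, hc, e⟩ := ih (by omega)
    have hkn : (0 : ℝ) < n - k := sub_pos.2 (by exact_mod_cast hk)
    refine ⟨(k + 1) * (n - k) * c, by positivity, ?_⟩
    nth_rewrite 1 [pow_succ']
    rw [← Matrix.mulVec_mulVec, form_mulVec hJ, lower_mulVec_pow hXY h hv hYv, Matrix.mulVec_smul, dotProduct_smul, e]
    push_cast
    rw [smul_eq_mul]
    ring

/-- A nonzero even lowest weight `-n` is impossible if the `J`-form is negative on weight `-n`
and nonnegative on weight `n`. -/
lemma eq_zero_of_even_weight (hXY : X * Y - Y * X = H) (h : H * X - X * H = (2 : ℂ) • X)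
    (hJ : Xᴴ * J = -(J * Y)) {n : ℕ} (hn : Even n) {v : ι → ℂ}
    (hv : H *ᵥ v = (-n : ℂ) • v) (hYv : Y *ᵥ v = 0)
    (hneg : v ≠ 0 → (star v ⬝ᵥ (J *ᵥ v)).re < 0)
    (hpos : ∀ w, H *ᵥ w = (n : ℂ) • w → 0 ≤ (star w ⬝ᵥ (J *ᵥ w)).re) : v = 0 := by
  by_contra hv0
  obtain ⟨c, hc, e⟩ := exists_form_pow hXY h hJ hv hYv n le_rfl
  have hw := hpos (X ^ n *ᵥ v) (by rw [mulVec_weight_pow h hv]; ring_nf)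
  rw [e, hn.neg_one_pow, one_mul, Complex.re_ofReal_mul] at hw
  exact absurd hw (not_le.2 (mul_neg_of_pos_of_neg hc (hneg hv0)))

end Strings

section Blocks

open scoped ComplexOrder

variable {p : Type*} [Fintype p]

lemma re_star_dotProduct_nonneg (a : p → ℂ) : 0 ≤ (star a ⬝ᵥ a).re :=
  (Complex.nonneg_iff.1 (dotProduct_star_self_nonneg a)).1

lemma re_star_dotProduct_pos {a : p → ℂ} (ha : a ≠ 0) : 0 < (star a ⬝ᵥ a).re :=
  (Complex.pos_iff.1 (dotProduct_star_self_pos_iff.2 ha)).1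

/-- `M * Mᴴ` has no negative eigenvalue. -/
lemma eq_zero_of_mul_conjTranspose_mulVec {M : Matrix p p ℂ} {n : ℕ} (hn : 0 < n) {b : p → ℂ}
    (h : M *ᵥ (Mᴴ *ᵥ b) = (-n : ℂ) • b) : b = 0 := by
  by_contra hb
  have h1 : star (Mᴴ *ᵥ b) ⬝ᵥ (Mᴴ *ᵥ b) = (-n : ℝ) * (star b ⬝ᵥ b) := by
    rw [Matrix.star_mulVec, conjTranspose_conjTranspose, ← Matrix.dotProduct_mulVec, h,
      dotProduct_smul, smul_eq_mul]
    simp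
  have h2 := re_star_dotProduct_nonneg (Mᴴ *ᵥ b)
  rw [h1, Complex.re_ofReal_mul] at h2
  have hn' : (0 : ℝ) < n := by exact_mod_cast hn
  nlinarith [mul_pos hn' (re_star_dotProduct_pos hb)]

/-- In a weight space of positive weight killed by `X`, the second component vanishes. -/
lemma inr_eq_zero_of_highest_weight {E F Z : Matrix p p ℂ} {A : Matrix p p ℂ} {n : ℕ} (hn : 0 < n)
    (htop : ∀ w, fromBlocks A 0 0 (Fᴴ * F - F * Fᴴ - Zᴴ * Z) *ᵥ w = (n : ℂ) • w →
      fromBlocks E Z 0 F *ᵥ w = 0)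
    {a b : p → ℂ} (hw : fromBlocks A 0 0 (Fᴴ * F - F * Fᴴ - Zᴴ * Z) *ᵥ Sum.elim a b =
      (n : ℂ) • Sum.elim a b) : b = 0 := by
  have hb : (Fᴴ * F - F * Fᴴ - Zᴴ * Z) *ᵥ b = (n : ℂ) • b := by
    ext i
    simpa [Matrix.fromBlocks_mulVec] using congrFun hw (Sum.inr i)
  have hX := htop (Sum.elim 0 b) (by
    ext (i | i)
    · simp [Matrix.fromBlocks_mulVec]
    · simpa [Matrix.fromBlocks_mulVec] using congrFun hb i)
  have hZ : Z *ᵥ b = 0 := by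
    ext i
    simpa [Matrix.fromBlocks_mulVec] using congrFun hX (Sum.inl i)
  have hF : F *ᵥ b = 0 := by
    ext i
    simpa [Matrix.fromBlocks_mulVec] using congrFun hX (Sum.inr i)
  refine eq_zero_of_mul_conjTranspose_mulVec (M := F) hn ?_
  rw [Matrix.sub_mulVec, Matrix.sub_mulVec, ← Matrix.mulVec_mulVec, ← Matrix.mulVec_mulVec,
    ← Matrix.mulVec_mulVec, hF, hZ] at hb
  rw [neg_smul, ← hb]
  simp

/-- In a weight space of negative weight killed by `Y`, the first component vanishes. -/
lemma inl_eq_zero_of_lowest_weight {E F Z : Matrix p p ℂ} {D : Matrix p p ℂ} {n : ℕ} (hn : 0 < n)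
    (hbot : ∀ w, fromBlocks (Z * Zᴴ - E * Eᴴ + Eᴴ * E) 0 0 D *ᵥ w = (-n : ℂ) • w →
      fromBlocks (-Eᴴ) 0 Zᴴ (-Fᴴ) *ᵥ w = 0)
    {a b : p → ℂ} (hw : fromBlocks (Z * Zᴴ - E * Eᴴ + Eᴴ * E) 0 0 D *ᵥ Sum.elim a b =
      (-n : ℂ) • Sum.elim a b) : a = 0 := by
  have ha : (Z * Zᴴ - E * Eᴴ + Eᴴ * E) *ᵥ a = (-n : ℂ) • a := by
    ext i
    simpa [Matrix.fromBlocks_mulVec] using congrFun hw (Sum.inl i)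
  have hY := hbot (Sum.elim a 0) (by
    ext (i | i)
    · simpa [Matrix.fromBlocks_mulVec] using congrFun ha i
    · simp [Matrix.fromBlocks_mulVec])
  have hE : Eᴴ *ᵥ a = 0 := by
    ext i
    simpa [Matrix.fromBlocks_mulVec, Matrix.neg_mulVec] using congrFun hY (Sum.inl i)
  have hZ : Zᴴ *ᵥ a = 0 := by
    ext i
    simpa [Matrix.fromBlocks_mulVec] using congrFun hY (Sum.inr i)
  refine eq_zero_of_mul_conjTranspose_mulVec (M := Eᴴ) hn ?_
  rw [Matrix.add_mulVec, Matrix.sub_mulVec, ← Matrix.mulVec_mulVec, ← Matrix.mulVec_mulVec,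
    ← Matrix.mulVec_mulVec, hE, hZ] at ha
  rw [← ha]
  simp

/-- The block matrix of `⁅X, Y⁆` is Hermitian. -/
lemma isHermitian_commutator {E F Z : Matrix p p ℂ} :
    (fromBlocks (Z * Zᴴ - E * Eᴴ + Eᴴ * E) 0 0 (Fᴴ * F - F * Fᴴ - Zᴴ * Z)).IsHermitian := by
  simp [Matrix.IsHermitian, fromBlocks_conjTranspose]

variable [DecidableEq p]

/-- The form attached to `diag(1, -1)` is `|a|² - |b|²`. -/
lemma form_elim (a b : p → ℂ) :
    star (Sum.elim a b) ⬝ᵥ ((fromBlocks 1 0 0 (-1) : Matrix (p ⊕ p) (p ⊕ p) ℂ) *ᵥ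
      Sum.elim a b) = star a ⬝ᵥ a - star b ⬝ᵥ b := by
  simp [Matrix.fromBlocks_mulVec, dotProduct, Fintype.sum_sum_type, sub_eq_add_neg,
    Matrix.neg_mulVec]

/-- The blocks of `⁅X, Y⁆`. -/
lemma commutator_fromBlocks {E F Z : Matrix p p ℂ} (hEZ : Eᴴ * Z = Z * Fᴴ) :
    fromBlocks E Z 0 F * fromBlocks (-Eᴴ) 0 Zᴴ (-Fᴴ) -
      fromBlocks (-Eᴴ) 0 Zᴴ (-Fᴴ) * fromBlocks E Z 0 F =
    fromBlocks (Z * Zᴴ - E * Eᴴ + Eᴴ * E) 0 0 (Fᴴ * F - F * Fᴴ - Zᴴ * Z) := by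
  have hZE : Zᴴ * E = F * Zᴴ := by simpa using congrArg conjTranspose hEZ
  rw [fromBlocks_multiply, fromBlocks_multiply, sub_eq_add_neg, fromBlocks_neg, fromBlocks_add]
  congr 1 <;> simp [hZE, hEZ] <;> abel

/-- An even weight of maximal absolute value among the weights vanishes. -/
lemma eq_zero_of_extremal_weight {E F Z : Matrix p p ℂ} {X Y H : Matrix (p ⊕ p) (p ⊕ p) ℂ}
    (hX : X = fromBlocks E Z 0 F) (hY : Y = fromBlocks (-Eᴴ) 0 Zᴴ (-Fᴴ))
    (hXY : X * Y - Y * X = H) (hEZ : Eᴴ * Z = Z * Fᴴ)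
    (hHX : H * X - X * H = (2 : ℂ) • X) (hHY : H * Y - Y * H = (-2 : ℂ) • Y)
    {n : ℕ} (hn : Even n) (hn0 : 0 < n)
    (htop : ∀ w, H *ᵥ w = (n + 2 : ℂ) • w → w = 0)
    (hbot : ∀ w, H *ᵥ w = (-n + -2 : ℂ) • w → w = 0)
    {v : p ⊕ p → ℂ} (hv : H *ᵥ v = (n : ℂ) • v ∨ H *ᵥ v = (-n : ℂ) • v) : v = 0 := by
  have hHb : H = fromBlocks (Z * Zᴴ - E * Eᴴ + Eᴴ * E) 0 0 (Fᴴ * F - F * Fᴴ - Zᴴ * Z) := by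
    rw [← hXY, hX, hY, commutator_fromBlocks hEZ]
  have hXtop : ∀ w, H *ᵥ w = (n : ℂ) • w → X *ᵥ w = 0 := fun w hw ↦
    htop _ (mulVec_weight hHX hw)
  have hYbot : ∀ w, H *ᵥ w = (-n : ℂ) • w → Y *ᵥ w = 0 := fun w hw ↦
    hbot _ (mulVec_weight hHY hw)
  set J : Matrix (p ⊕ p) (p ⊕ p) ℂ := fromBlocks 1 0 0 (-1) with hJ
  have hpos : ∀ w, H *ᵥ w = (n : ℂ) • w → w ≠ 0 → 0 < (star w ⬝ᵥ (J *ᵥ w)).re := by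
    intro w hw hw0
    obtain ⟨a, b, rfl⟩ : ∃ a b, w = Sum.elim a b := ⟨_, _, (Sum.elim_comp_inl_inr w).symm⟩
    obtain rfl : b = 0 := by
      subst hX hHb
      exact inr_eq_zero_of_highest_weight hn0 hXtop hw
    have ha : a ≠ 0 := by
      rintro rfl
      exact hw0 (by ext (i | i) <;> simp)
    simpa [hJ, form_elim] using re_star_dotProduct_pos ha
  have hneg : ∀ w, H *ᵥ w = (-n : ℂ) • w → w ≠ 0 → (star w ⬝ᵥ (J *ᵥ w)).re < 0 := by
    intro w hw hw0
    obtain ⟨a, b, rfl⟩ : ∃ a b, w = Sum.elim a b := ⟨_, _, (Sum.elim_comp_inl_inr w).symm⟩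
    obtain rfl : a = 0 := by
      subst hY hHb
      exact inl_eq_zero_of_lowest_weight hn0 hYbot hw
    have hb : b ≠ 0 := by
      rintro rfl
      exact hw0 (by ext (i | i) <;> simp)
    simpa [hJ, form_elim] using re_star_dotProduct_pos hb
  have hXJ : Xᴴ * J = -(J * Y) := by
    simp [hX, hY, hJ, fromBlocks_conjTranspose, fromBlocks_multiply, fromBlocks_neg]
  have hYJ : Yᴴ * -J = -(-J * X) := by
    simp [hX, hY, hJ, fromBlocks_conjTranspose, fromBlocks_multiply, fromBlocks_neg]
  rcases hv with hv | hv
  · refine eq_zero_of_even_weight (X := Y) (Y := X) (H := -H) (J := -J) ?_ ?_ hYJ hn ?_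
      (hXtop v hv) ?_ ?_
    · rw [← hXY]; abel
    · rw [neg_mul, mul_neg, ← neg_sub', hHY, ← neg_smul, neg_neg]
    · rw [Matrix.neg_mulVec, hv, neg_smul]
    · intro hv0
      simpa [Matrix.neg_mulVec] using hpos v hv hv0
    · intro w hw
      by_cases hw0 : w = 0
      · simp [hw0]
      · have := hneg w (by rw [neg_smul, ← hw, Matrix.neg_mulVec, neg_neg]) hw0
        simpa [Matrix.neg_mulVec] using this.le
  · refine eq_zero_of_even_weight hXY hHX hXJ hn hv (hYbot v hv) (hneg v hv) fun w hw ↦ ?_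
    by_cases hw0 : w = 0
    · simp [hw0]
    · exact (hpos w hw hw0).le

end Blocks

end Sl2Blocks

/-- If `X = fromBlocks E Z 0 F`, `Y = fromBlocks (-Eᴴ) 0 Zᴴ (-Fᴴ)` and
`H = ⁅X,Y⁆` form an `sl₂`-triple with `Eᴴ * Z = Z * Fᴴ`, and every complex
eigenvalue of `H` (every root of its characteristic polynomial) is an even
integer, then `E = 0`, `F = 0`, `Z = 0`, hence `X = 0`, `Y = 0`, `H = 0`:
the representation of `sl(2)` on the even part of the eigenspace decomposition
is trivial. -/
theorem sl2_triple_even_eigenvalues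
    (p : ℕ) (hp : 1 ≤ p)
    (E F Z : Matrix (Fin p) (Fin p) ℂ)
    (X Y H : Matrix (Fin p ⊕ Fin p) (Fin p ⊕ Fin p) ℂ)
    (hX : X = Matrix.fromBlocks E Z 0 F)
    (hY : Y = Matrix.fromBlocks (-Eᴴ) 0 Zᴴ (-Fᴴ))
    (hH : H = ⁅X, Y⁆)
    (hEZ : Eᴴ * Z = Z * Fᴴ)
    (hHX : ⁅H, X⁆ = (2 : ℂ) • X)
    (hHY : ⁅H, Y⁆ = (-2 : ℂ) • Y)
    (heven : ∀ μ : ℂ, (Matrix.charpoly H).IsRoot μ → ∃ k : ℤ, Even k ∧ μ = (k : ℂ)) :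
    E = 0 ∧ F = 0 ∧ Z = 0 ∧ X = 0 ∧ Y = 0 ∧ H = 0 := by
  have hXY : X * Y - Y * X = H := by rw [hH, Ring.lie_def]
  rw [Ring.lie_def] at hHX hHY
  have key : ∀ μ, H.charpoly.IsRoot μ → μ = 0 := by
    have hne : H.charpoly ≠ 0 := H.charpoly_monic.ne_zero
    intro ν hν
    obtain ⟨μ, hμ, hmax⟩ := H.charpoly.roots.toFinset.exists_max_image (fun z ↦ ‖z‖)
      ⟨ν, by simpa [hne] using hν⟩
    simp only [Multiset.mem_toFinset, Polynomial.mem_roots hne] at hμ hmax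
    obtain ⟨k, hk, rfl⟩ := heven μ hμ
    have hbig : ∀ z : ℂ, (k.natAbs : ℝ) < ‖z‖ → ∀ w, H *ᵥ w = z • w → w = 0 := by
      intro z hz w hw
      by_contra hw0
      have := hmax z ((Sl2Blocks.isRoot_charpoly_iff H z).2 ⟨w, hw0, hw⟩)
      rw [Complex.norm_intCast, ← Int.cast_abs, Int.abs_eq_natAbs, Int.cast_natCast] at this
      exact absurd hz (not_lt.2 this)
    have hnorm : ‖(k.natAbs + 2 : ℂ)‖ = k.natAbs + 2 := by
      exact_mod_cast Complex.norm_natCast (k.natAbs + 2)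
    obtain ⟨v, hv0, hv⟩ := (Sl2Blocks.isRoot_charpoly_iff H _).1 hμ
    have hk0 : k = 0 := by
      by_contra hk0
      refine hv0 (Sl2Blocks.eq_zero_of_extremal_weight hX hY hXY hEZ hHX hHY
        (Int.natAbs_even.2 hk) (Int.natAbs_pos.2 hk0) (hbig _ ?_) (hbig _ ?_) ?_)
      · rw [hnorm]; linarith
      · rw [← neg_add, norm_neg, hnorm]; linarith
      · rcases Int.natAbs_eq k with h | h <;> rw [h] at hv
        · exact Or.inl (by simpa using hv)
        · exact Or.inr (by simpa using hv)
    simpa [hk0] using hmax ν hν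
  have hHerm : H.IsHermitian := by
    rw [← hXY, hX, hY, Sl2Blocks.commutator_fromBlocks hEZ]
    exact Sl2Blocks.isHermitian_commutator
  have hH0 : H = 0 := by
    refine hHerm.eigenvalues_eq_zero_iff.1 (funext fun i ↦ ?_)
    have hroot : H.charpoly.IsRoot (hHerm.eigenvalues i : ℂ) := by
      rw [Polynomial.IsRoot, hHerm.charpoly_eq, Polynomial.eval_prod]
      exact Finset.prod_eq_zero (Finset.mem_univ i) (by simp)
    simpa using key _ hroot
  have hX0 : X = 0 := by simpa [hH0] using hHX.symm
  have hY0 : Y = 0 := by simpa [hH0] using hHY.symm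
  have hblocks := hX.symm.trans (hX0.trans fromBlocks_zero.symm)
  obtain ⟨hE, hZ, -, hF⟩ := fromBlocks_inj.1 hblocks
  exact ⟨hE, hF, hZ, hX0, hY0, hH0⟩
end

section
/- Let n ≥ 1 and let A be an n×n complex matrix satisfying ⁅A, ⁅A, Aᴴ⁆⁆ = 2•A (equivalently, ⁅S, A⁆ = 2•A where S = ⁅Aᴴ, A⁆ = Aᴴ*A - A*Aᴴ is the Hermitian matrix measuring the failure of A to be normal). Then A = 0. (This is the mechanism by which the diagonal-block components E and F of the embedding are forced to vanish: an operator that raises the eigenvalues of the self-commutator by 2 must be zero, since the top eigenvalue of S is nonpositive and its bottom eigenvalue is nonnegative.) -/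
open Matrix
open scoped ComplexOrder

/-- An `n × n` complex matrix `A` satisfying `⁅A, ⁅A, Aᴴ⁆⁆ = 2•A`
(equivalently `⁅S, A⁆ = 2•A` with `S = ⁅Aᴴ, A⁆` the self-commutator) is zero:
an operator raising the eigenvalues of the self-commutator by `2` must vanish,
since the top eigenvalue of `S` is nonpositive and its bottom eigenvalue is
nonnegative. -/
theorem raising_self_commutator_eq_zero
    (n : ℕ) (hn : 1 ≤ n)
    (A : Matrix (Fin n) (Fin n) ℂ)
    (h : ⁅A, ⁅A, Aᴴ⁆⁆ = (2 : ℂ) • A) :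
    A = 0 := by
  have self_adj : ⁅A, Aᴴ⁆ᴴ = ⁅A, Aᴴ⁆ := by simp [Ring.lie_def]
  have trace_eq : (⁅A, Aᴴ⁆ᴴ * ⁅A, Aᴴ⁆).trace + 2 * (Aᴴ * A).trace = 0 := by
    have key : (Aᴴ * ⁅A, ⁅A, Aᴴ⁆⁆).trace = -(⁅A, Aᴴ⁆ * ⁅A, Aᴴ⁆).trace := by
      rw [Ring.lie_def A ⁅A, Aᴴ⁆, mul_sub, trace_sub, trace_mul_comm Aᴴ (⁅A, Aᴴ⁆ * A),
        Matrix.mul_assoc, trace_mul_comm ⁅A, Aᴴ⁆ (A * Aᴴ), ← Matrix.mul_assoc, ← trace_sub,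
        ← sub_mul, ← trace_neg, ← neg_mul, Ring.lie_def, neg_sub]
    rw [h, Matrix.mul_smul, trace_smul, smul_eq_mul] at key
    rw [self_adj, key, add_neg_cancel]
  have comm_nonneg := (posSemidef_conjTranspose_mul_self ⁅A, Aᴴ⁆).trace_nonneg
  have nonneg := (posSemidef_conjTranspose_mul_self A).trace_nonneg
  have two_nonneg : 0 ≤ 2 * (Aᴴ * A).trace := mul_nonneg zero_le_two nonneg
  have zero := ((add_eq_zero_iff_of_nonneg comm_nonneg two_nonneg).mp trace_eq).2
  exact trace_conjTranspose_mul_self_eq_zero_iff.mp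
    ((mul_eq_zero.mp zero).resolve_left two_ne_zero)
end

section
/- Let p ≥ 1 and let E, F, Z be p×p complex matrices with Z injective (as a linear map ℂᵖ → ℂᵖ, equivalently Z invertible). Set X = fromBlocks E Z 0 F, Y = fromBlocks (-Eᴴ) 0 Zᴴ (-Fᴴ), and H = ⁅X, Y⁆. Assume Eᴴ * Z = Z * Fᴴ, ⁅H, X⁆ = 2•X, and ⁅H, Y⁆ = -2•Y. Then E = 0, F = 0, Z is unitary (Z*Zᴴ = 1 and Zᴴ*Z = 1), and H = fromBlocks 1 0 0 (-1). -/
open Matrix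

lemma fromBlocks_sub_fromBlocks {l m n o α : Type*} [AddGroup α]
    (A A' : Matrix n l α) (B B' : Matrix n m α) (C C' : Matrix o l α) (D D' : Matrix o m α) :
    fromBlocks A B C D - fromBlocks A' B' C' D' =
      fromBlocks (A - A') (B - B') (C - C') (D - D') := by
  simp [sub_eq_add_neg, fromBlocks_neg, fromBlocks_add]

/-- A matrix that lowers the real parts of eigenvalues of `A` by `2` kills some eigenvector of `A`
whose eigenvalue has minimal real part. -/
lemma exists_eigenvector_min_re_of_lowering {n : Type*} [Fintype n] [DecidableEq n]
    {A N : Matrix n n ℂ} (hN : A * N - N * A = (-2 : ℂ) • N)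
    {c : ℂ} {v : n → ℂ} (hv : v ≠ 0) (hAv : A *ᵥ v = c • v) :
    ∃ (d : ℂ) (w : n → ℂ), w ≠ 0 ∧ A *ᵥ w = d • w ∧ N *ᵥ w = 0 ∧ d.re ≤ c.re := by
  have hasEig {c : ℂ} {v : n → ℂ} (hv : v ≠ 0) (h : A *ᵥ v = c • v) :
      Module.End.HasEigenvalue (Matrix.toLin' A) c :=
    Module.End.hasEigenvalue_of_hasEigenvector
      ⟨Module.End.mem_eigenspace_iff.mpr (by simpa using h), hv⟩
  obtain ⟨d, hd, hmin⟩ := Set.exists_min_image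
    {d : ℂ | Module.End.HasEigenvalue (Matrix.toLin' A) d} Complex.re
    (Module.End.finite_hasEigenvalue _) ⟨c, hasEig hv hAv⟩
  obtain ⟨w, hw⟩ := Module.End.HasEigenvalue.exists_hasEigenvector hd
  have hAw : A *ᵥ w = d • w := by simpa using hw.apply_eq_smul
  refine ⟨d, w, hw.2, hAw, ?_, hmin c (hasEig hv hAv)⟩
  by_contra hNw
  have hANw : A *ᵥ (N *ᵥ w) = (d - 2) • (N *ᵥ w) := by
    have hAN : A * N = N * A + (-2 : ℂ) • N := by rw [← hN]; abel
    rw [mulVec_mulVec, hAN, add_mulVec, ← mulVec_mulVec, hAw, mulVec_smul, smul_mulVec]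
    module
  have := hmin _ (hasEig hNw hANw)
  norm_num at this

open scoped ComplexOrder in
/-- If `N` lowers the eigenvalues of `A = W * Wᴴ + N * Nᴴ - Nᴴ * N` by `2` and `Wᴴ` is injective,
then all eigenvalues of `A` have positive real part. -/
lemma re_eigenvalue_pos_of_lowering {n : Type*} [Fintype n] [DecidableEq n]
    {A N W : Matrix n n ℂ} (hN : A * N - N * A = (-2 : ℂ) • N)
    (hA : A = W * Wᴴ + N * Nᴴ - Nᴴ * N) (hW : ∀ v, Wᴴ *ᵥ v = 0 → v = 0)
    {c : ℂ} {v : n → ℂ} (hv : v ≠ 0) (hAv : A *ᵥ v = c • v) : 0 < c.re := by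
  obtain ⟨d, w, hw, hAw, hNw, hdc⟩ := exists_eigenvector_min_re_of_lowering hN hv hAv
  refine lt_of_lt_of_le ?_ hdc
  have key : d * (star w ⬝ᵥ w) =
      star (Wᴴ *ᵥ w) ⬝ᵥ (Wᴴ *ᵥ w) + star (Nᴴ *ᵥ w) ⬝ᵥ (Nᴴ *ᵥ w) := by
    rw [← smul_eq_mul, ← dotProduct_smul, ← hAw, hA, sub_mulVec, add_mulVec,
      ← mulVec_mulVec w Nᴴ N, hNw, mulVec_zero, sub_zero, dotProduct_add]
    simp only [star_mulVec, conjTranspose_conjTranspose, dotProduct_mulVec, vecMul_vecMul]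
  have hpos := dotProduct_star_self_pos_iff.mpr hw
  have hWpos := dotProduct_star_self_pos_iff.mpr (fun h => hw (hW w h))
  have hprod := add_pos_of_pos_of_nonneg hWpos (dotProduct_star_self_nonneg (Nᴴ *ᵥ w))
  rw [← key] at hprod
  rw [Complex.pos_iff] at hpos hprod
  rw [Complex.mul_re, ← hpos.2, mul_zero, sub_zero] at hprod
  exact pos_of_mul_pos_left hprod.1 hpos.1.le

/-- A Hermitian matrix whose eigenvectors are all killed by `E` forces `E = 0`. -/
lemma Matrix.IsHermitian.eq_zero_of_mulVec_eigenvector_eq_zero {n : Type*} [Fintype n]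
    [DecidableEq n] {A E : Matrix n n ℂ} (hA : A.IsHermitian)
    (h : ∀ (c : ℂ) (v : n → ℂ), v ≠ 0 → A *ᵥ v = c • v → E *ᵥ v = 0) : E = 0 := by
  apply (Matrix.toEuclideanLin (𝕜 := ℂ)).injective
  refine hA.eigenvectorBasis.toBasis.ext fun i => ?_
  have := h (hA.eigenvalues i) (hA.eigenvectorBasis i).ofLp
    (by simpa using hA.eigenvectorBasis.toBasis.ne_zero i)
    (by simpa using hA.mulVec_eigenvectorBasis i)
  ext j
  simpa using congrFun this j

/-- If `X = fromBlocks E Z 0 F`, `Y = fromBlocks (-Eᴴ) 0 Zᴴ (-Fᴴ)` and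
`H = ⁅X,Y⁆` form an `sl₂`-triple with `Eᴴ * Z = Z * Fᴴ`, and `Z` is injective
as a linear map `ℂᵖ → ℂᵖ`, then `E = 0`, `F = 0`, `Z` is unitary, and
`H = fromBlocks 1 0 0 (-1)`. -/
theorem sl2_triple_injective_Z
    (p : ℕ) (hp : 1 ≤ p)
    (E F Z : Matrix (Fin p) (Fin p) ℂ)
    (hZ : Function.Injective Z.mulVecLin)
    (X Y H : Matrix (Fin p ⊕ Fin p) (Fin p ⊕ Fin p) ℂ)
    (hX : X = Matrix.fromBlocks E Z 0 F)
    (hY : Y = Matrix.fromBlocks (-Eᴴ) 0 Zᴴ (-Fᴴ))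
    (hH : H = ⁅X, Y⁆)
    (hEZ : Eᴴ * Z = Z * Fᴴ)
    (hHX : ⁅H, X⁆ = (2 : ℂ) • X)
    (hHY : ⁅H, Y⁆ = (-2 : ℂ) • Y) :
    E = 0 ∧ F = 0 ∧ Z * Zᴴ = 1 ∧ Zᴴ * Z = 1 ∧
    H = Matrix.fromBlocks 1 0 0 (-1) := by
  have hZdet : IsUnit Z := Matrix.mulVec_injective_iff_isUnit.mp hZ
  have hZdet' : IsUnit Zᴴ := hZdet.star
  have hZE : Zᴴ * E = F * Zᴴ := by
    simpa [conjTranspose_mul] using congrArg conjTranspose hEZ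
  set A := Z * Zᴴ + Eᴴ * E - E * Eᴴ with hA
  set B := Zᴴ * Z + F * Fᴴ - Fᴴ * F with hB
  have hHb : H = fromBlocks A 0 0 (-B) := by
    rw [hH, Ring.lie_def, hX, hY, fromBlocks_multiply, fromBlocks_multiply, fromBlocks_sub_fromBlocks,
      hA, hB]
    congr 1
    · simp; abel
    · simp [hEZ]
    · simp [hZE]
    · simp; abel
  have hAE : A * E - E * A = (2 : ℂ) • E := by
    simpa [Ring.lie_def, hHb, hX, fromBlocks_multiply, fromBlocks_smul,
      fromBlocks_sub_fromBlocks, fromBlocks_neg]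
      using congrArg toBlocks₁₁ hHX
  have hAZ : A * Z + Z * B = (2 : ℂ) • Z := by
    simpa [Ring.lie_def, hHb, hX, fromBlocks_multiply, fromBlocks_smul,
      fromBlocks_sub_fromBlocks, fromBlocks_neg]
      using congrArg toBlocks₁₂ hHX
  have hBF : B * F - F * B = (-2 : ℂ) • F := by
    have := congrArg toBlocks₂₂ hHX
    simp [Ring.lie_def, hHb, hX, fromBlocks_multiply, fromBlocks_smul,
      fromBlocks_sub_fromBlocks] at this
    rw [neg_smul, ← this]; abel
  have hAE' : A * Eᴴ - Eᴴ * A = (-2 : ℂ) • Eᴴ := by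
    have := congrArg toBlocks₁₁ hHY
    simp [Ring.lie_def, hHb, hY, fromBlocks_multiply, fromBlocks_smul,
      fromBlocks_sub_fromBlocks, fromBlocks_neg] at this
    rw [neg_smul, ← this]; abel
  have hker {M : Matrix (Fin p) (Fin p) ℂ} (hM : IsUnit M) (v : Fin p → ℂ) (hv : M *ᵥ v = 0) :
      v = 0 :=
    Matrix.mulVec_injective_iff_isUnit.mpr hM (by rw [hv, mulVec_zero])
  have hApos {c : ℂ} {v : Fin p → ℂ} (hv : v ≠ 0) (hAv : A *ᵥ v = c • v) : 0 < c.re :=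
    re_eigenvalue_pos_of_lowering hAE' (by simp [hA]) (hker hZdet') hv hAv
  have hBpos {c : ℂ} {v : Fin p → ℂ} (hv : v ≠ 0) (hBv : B *ᵥ v = c • v) : 0 < c.re :=
    re_eigenvalue_pos_of_lowering (W := Zᴴ) hBF (by simp [hB]) (by simpa using hker hZdet) hv hBv
  have hAlt {c : ℂ} {v : Fin p → ℂ} (hv : v ≠ 0) (hAv : A *ᵥ v = c • v) : c.re < 2 := by
    obtain ⟨u, rfl⟩ := Matrix.mulVec_surjective_iff_isUnit.mpr hZdet v
    have hu : u ≠ 0 := by rintro rfl; simp at hv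
    have hBu : B *ᵥ u = (2 - c) • u := by
      apply Matrix.mulVec_injective_iff_isUnit.mpr hZdet
      have := congrArg (· *ᵥ u) hAZ
      simp only [add_mulVec, smul_mulVec, ← mulVec_mulVec, hAv] at this
      rw [mulVec_smul, sub_smul, ← this]
      abel
    have := hBpos hu hBu
    simp at this
    exact this
  have hAherm : A.IsHermitian :=
    ((isHermitian_mul_conjTranspose_self Z).add (isHermitian_conjTranspose_mul_self E)).sub
      (isHermitian_mul_conjTranspose_self E)
  have hE : E = 0 := by
    refine hAherm.eq_zero_of_mulVec_eigenvector_eq_zero fun c v hv hAv => ?_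
    by_contra hEv
    have hAEv : A *ᵥ (E *ᵥ v) = (c + 2) • (E *ᵥ v) := by
      rw [mulVec_mulVec, sub_eq_iff_eq_add.mp hAE, add_mulVec, ← mulVec_mulVec, hAv, mulVec_smul,
        smul_mulVec]
      module
    have h1 := hApos hv hAv
    have h2 := hAlt hEv hAEv
    simp at h2
    linarith
  have hF : F = 0 := by
    rw [hE, mul_zero] at hZE
    exact hZdet'.mul_left_eq_zero.mp hZE.symm
  have hA' : A = Z * Zᴴ := by simp [hA, hE]
  have hB' : B = Zᴴ * Z := by simp [hB, hF]
  have hZZ : Z * Zᴴ = 1 := by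
    rw [hA', hB', ← mul_assoc, ← two_smul ℂ] at hAZ
    apply hZdet.mul_right_cancel
    rw [one_mul]
    exact smul_right_injective _ (two_ne_zero (α := ℂ)) hAZ
  have hZZ' : Zᴴ * Z = 1 := mul_eq_one_comm.mp hZZ
  exact ⟨hE, hF, hZZ, hZZ', by rw [hHb, hA', hB', hZZ, hZZ']⟩
end
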